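/- arXiv:1608.04184 — 2 statements merged into one kernel-verified Lean document; each statement's English description precedes it below -/
import Mathlib

section
/- Let H be a self-adjoint operator on a separable complex Hilbert space ℋ with spectral measure E, and let F : ℋ → 𝒦 be a rigging operator. Then the spectral measure E of H is purely absolutely continuous on the set Λ(H, F), and for every f ∈ ℋ, (1/π) ∫_{Λ(H,F)} lim_{y→0^+} ⟨f, Im R_{λ+iy}(H) f⟩ dλ = ‖E(Λ(H,F)) f‖². -/
open MeasureTheory Filter Complex Set Topology
open scoped InnerProductSpace ComplexInnerProductSpace ENNReal Topology Real
set_option autoImplicit false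

noncomputable section

namespace SSF

variable {𝓗 : Type*} {𝓚 : Type*}

section TraceClass

variable [NormedAddCommGroup 𝓗] [InnerProductSpace ℂ 𝓗]
variable [NormedAddCommGroup 𝓚] [InnerProductSpace ℂ 𝓚]

/-- A bounded operator `T` on a Hilbert space is trace class iff the sums
`∑ |⟪e i, T (f i)⟫|` over finite orthonormal families `e,f` are uniformly bounded. -/
def IsTraceClass (T : 𝓗 →L[ℂ] 𝓗) : Prop :=
  ∃ C : ℝ, ∀ (n : ℕ) (e f : Fin n → 𝓗), Orthonormal ℂ e → Orthonormal ℂ f →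
    ∑ i, ‖⟪e i, T (f i)⟫_ℂ‖ ≤ C

/-- The trace norm of a bounded operator: the supremum of `∑ |⟪e i, T (f i)⟫|` over
finite orthonormal families `e,f`. -/
def traceNorm (T : 𝓗 →L[ℂ] 𝓗) : ℝ :=
  sSup {c : ℝ | ∃ (n : ℕ) (e f : Fin n → 𝓗), Orthonormal ℂ e ∧ Orthonormal ℂ f ∧
    c = ∑ i, ‖⟪e i, T (f i)⟫_ℂ‖}

/-- The trace of a bounded operator, computed in a Hilbert basis (meaningful for
trace class operators). -/
def trace [CompleteSpace 𝓗] (T : 𝓗 →L[ℂ] 𝓗) : ℂ :=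
  ∑' i : (exists_hilbertBasis ℂ 𝓗).choose, ⟪(i : 𝓗), T (i : 𝓗)⟫_ℂ

/-- A bounded operator between Hilbert spaces is Hilbert-Schmidt iff the sums
`∑ ‖T (e i)‖ ^ 2` over finite orthonormal families are uniformly bounded. -/
def IsHilbertSchmidt (T : 𝓗 →L[ℂ] 𝓚) : Prop :=
  ∃ C : ℝ, ∀ (n : ℕ) (e : Fin n → 𝓗), Orthonormal ℂ e → ∑ i, ‖T (e i)‖ ^ 2 ≤ C

end TraceClass

variable [NormedAddCommGroup 𝓗] [InnerProductSpace ℂ 𝓗] [CompleteSpace 𝓗]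
variable [NormedAddCommGroup 𝓚] [InnerProductSpace ℂ 𝓚] [CompleteSpace 𝓚]

/-- A (possibly unbounded) self-adjoint operator on a Hilbert space, bundled together
with its resolvent `R_z = (H - z)⁻¹` at every nonreal `z`. -/
structure SelfAdjointOperator (𝓗 : Type*) [NormedAddCommGroup 𝓗]
    [InnerProductSpace ℂ 𝓗] [CompleteSpace 𝓗] where
  domain : Submodule ℂ 𝓗
  dense_domain : Dense (domain : Set 𝓗)
  op : domain →ₗ[ℂ] 𝓗
  symmetric : ∀ f g : domain, ⟪op f, (g : 𝓗)⟫_ℂ = ⟪(f : 𝓗), op g⟫_ℂ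
  resolvent : ℂ → (𝓗 →L[ℂ] 𝓗)
  resolvent_mem : ∀ z : ℂ, z.im ≠ 0 → ∀ f : 𝓗, resolvent z f ∈ domain
  resolvent_right : ∀ (z : ℂ) (hz : z.im ≠ 0) (f : 𝓗),
    op ⟨resolvent z f, resolvent_mem z hz f⟩ - z • resolvent z f = f
  resolvent_left : ∀ (z : ℂ), z.im ≠ 0 → ∀ g : domain,
    resolvent z (op g - z • (g : 𝓗)) = (g : 𝓗)

/-- `IsSum H0 V H1` encodes the relation `H1 = H0 + V` for a bounded perturbation `V`,
via the second resolvent identity (which characterises it uniquely). -/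
def IsSum (H0 : SelfAdjointOperator 𝓗) (V : 𝓗 →L[ℂ] 𝓗)
    (H1 : SelfAdjointOperator 𝓗) : Prop :=
  ∀ z : ℂ, z.im ≠ 0 →
    H1.resolvent z - H0.resolvent z = -(H1.resolvent z ∘L (V ∘L H0.resolvent z))

/-- Two self-adjoint operators are resolvent comparable if the difference of their
resolvents at some (hence any) nonreal point is trace class. -/
def ResolventComparable (H0 H1 : SelfAdjointOperator 𝓗) : Prop :=
  ∃ z : ℂ, z.im ≠ 0 ∧ IsTraceClass (H1.resolvent z - H0.resolvent z)

/-- The spectral measure of a self-adjoint operator `H`, bundled with the associated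
scalar spectral measures, the Borel functional calculus, and the decomposition into
absolutely continuous and singular parts. -/
structure SpectralMeasure (H : SelfAdjointOperator 𝓗) where
  proj : Set ℝ → (𝓗 →L[ℂ] 𝓗)
  proj_sa : ∀ s, IsSelfAdjoint (proj s)
  proj_mul : ∀ s t, proj (s ∩ t) = proj s ∘L proj t
  proj_univ : proj Set.univ = 1
  scalar : 𝓗 → Measure ℝ
  scalar_finite : ∀ f, IsFiniteMeasure (scalar f)
  scalar_spec : ∀ (f : 𝓗) (s : Set ℝ), MeasurableSet s →
    (scalar f s).toReal = (⟪f, proj s f⟫_ℂ).re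
  resolvent_spec : ∀ (z : ℂ), z.im ≠ 0 → ∀ f : 𝓗,
    ⟪f, H.resolvent z f⟫_ℂ = ∫ x : ℝ, ((x : ℂ) - z)⁻¹ ∂(scalar f)
  fc : (ℝ → ℂ) → (𝓗 →L[ℂ] 𝓗)
  fc_spec : ∀ (φ : ℝ → ℂ), Measurable φ → (∃ C, ∀ x, ‖φ x‖ ≤ C) →
    ∀ f : 𝓗, ⟪f, fc φ f⟫_ℂ = ∫ x : ℝ, φ x ∂(scalar f)
  acProj : Set ℝ → (𝓗 →L[ℂ] 𝓗)
  sProj : Set ℝ → (𝓗 →L[ℂ] 𝓗)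
  acProj_add_sProj : ∀ s, acProj s + sProj s = proj s
  acScalar : 𝓗 → Measure ℝ
  sScalar : 𝓗 → Measure ℝ
  acScalar_spec : ∀ (f : 𝓗) (s : Set ℝ), MeasurableSet s →
    (acScalar f s).toReal = (⟪f, acProj s f⟫_ℂ).re
  sScalar_spec : ∀ (f : 𝓗) (s : Set ℝ), MeasurableSet s →
    (sScalar f s).toReal = (⟪f, sProj s f⟫_ℂ).re
  acScalar_ac : ∀ f, acScalar f ≪ MeasureTheory.volume
  sScalar_sing : ∀ f, (sScalar f).MutuallySingular MeasureTheory.volume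

/-- The real-valued test function version of the functional calculus. -/
def SpectralMeasure.fcR {H : SelfAdjointOperator 𝓗} (E : SpectralMeasure H)
    (φ : ℝ → ℝ) : 𝓗 →L[ℂ] 𝓗 :=
  E.fc fun x => (φ x : ℂ)


/-- A rigging operator: a bounded operator with trivial kernel and dense range. -/
def IsRigging (F : 𝓗 →L[ℂ] 𝓚) : Prop :=
  Function.Injective F ∧ Dense (Set.range F)

/-- The perturbation `F* J F` determined by a rigging `F` and a bounded operator `J`. -/
def sandwich (F : 𝓗 →L[ℂ] 𝓚) (J : 𝓚 →L[ℂ] 𝓚) : 𝓗 →L[ℂ] 𝓗 :=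
  ContinuousLinearMap.adjoint F ∘L (J ∘L F)

/-- The sandwiched resolvent `T_z(H) = F R_z(H) F*`. -/
def Tz (F : 𝓗 →L[ℂ] 𝓚) (H : SelfAdjointOperator 𝓗) (z : ℂ) : 𝓚 →L[ℂ] 𝓚 :=
  F ∘L (H.resolvent z ∘L ContinuousLinearMap.adjoint F)

/-- The imaginary part `Im T = (T - T*)/2i` of a bounded operator. -/
def imOp (T : 𝓚 →L[ℂ] 𝓚) : 𝓚 →L[ℂ] 𝓚 :=
  ((2 * Complex.I)⁻¹) • (T - ContinuousLinearMap.adjoint T)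

/-- `Λ(H,F)`: the set of real points `l` at which the norm limit
`T_{l+i0}(H) = lim_{y→0⁺} T_{l+iy}(H)` exists. -/
def LambdaSet (F : 𝓗 →L[ℂ] 𝓚) (H : SelfAdjointOperator 𝓗) : Set ℝ :=
  {l : ℝ | ∃ L : 𝓚 →L[ℂ] 𝓚,
    Tendsto (fun y : ℝ => Tz F H ((l : ℂ) + y * Complex.I)) (𝓝[>] (0:ℝ)) (𝓝 L)}

/-- The norm limit `T_{l+i0}(H)` (meaningful for `l ∈ Λ(H,F)`). -/
def Tlim (F : 𝓗 →L[ℂ] 𝓚) (H : SelfAdjointOperator 𝓗) (l : ℝ) : 𝓚 →L[ℂ] 𝓚 :=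
  limUnder (𝓝[>] (0:ℝ)) (fun y : ℝ => Tz F H ((l : ℂ) + y * Complex.I))

/-- Convergence in trace norm along a filter. -/
def TendstoTraceNorm (f : ℝ → (𝓚 →L[ℂ] 𝓚)) (lf : Filter ℝ) (L : 𝓚 →L[ℂ] 𝓚) : Prop :=
  (∀ᶠ y in lf, IsTraceClass (f y - L)) ∧
  Tendsto (fun y : ℝ => traceNorm (f y - L)) lf (𝓝 0)

/-- `Λ(H,F;𝓛₁)`: the set of points `l ∈ Λ(H,F)` at which additionally
`Im T_{l+i0}(H)` exists in trace class. -/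
def LambdaSetTC (F : 𝓗 →L[ℂ] 𝓚) (H : SelfAdjointOperator 𝓗) : Set ℝ :=
  {l : ℝ | l ∈ LambdaSet F H ∧ ∃ M : 𝓚 →L[ℂ] 𝓚, IsTraceClass M ∧
    TendstoTraceNorm (fun y : ℝ => imOp (Tz F H ((l : ℂ) + y * Complex.I)))
      (𝓝[>] (0:ℝ)) M}

/-- `F` is an `H`-Hilbert-Schmidt rigging operator. -/
def IsHSRigging (F : 𝓗 →L[ℂ] 𝓚) (H : SelfAdjointOperator 𝓗) : Prop :=
  IsRigging F ∧ ∃ z : ℂ, z.im ≠ 0 ∧ IsHilbertSchmidt (F ∘L H.resolvent z)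

section PoissonIntegral

lemma poisson_eq_lintegral_indicator (x l : ℝ) {y : ℝ} (hy : 0 < y) :
    ENNReal.ofReal (y / ((x - l) ^ 2 + y ^ 2)) =
      ∫⁻ t in Ioi (0 : ℝ), {t : ℝ | |x - l| ≤ y * t}.indicator
        (fun t => ENNReal.ofReal (2 * t / (y * (1 + t ^ 2) ^ 2))) t := by
  set u := |x - l| / y with hu
  have hu0 : 0 ≤ u := by positivity
  have hset : {t : ℝ | |x - l| ≤ y * t} = Ici u := by
    ext t
    simp only [mem_ofPred_eq, mem_Ici, hu, div_le_iff₀ hy, mul_comm]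
  have hderiv : ∀ t ∈ Ici u, HasDerivAt (fun t : ℝ => -(y * (1 + t ^ 2))⁻¹)
      (2 * t / (y * (1 + t ^ 2) ^ 2)) t := by
    intro t _
    have h1 : HasDerivAt (fun t : ℝ => y * (1 + t ^ 2)) (y * (2 * t)) t := by
      simpa using ((hasDerivAt_pow 2 t).const_add 1).const_mul y
    refine (h1.inv (by positivity)).neg.congr_deriv ?_
    field_simp
  have hpos : ∀ t ∈ Ioi u, 0 ≤ 2 * t / (y * (1 + t ^ 2) ^ 2) := by
    intro t ht
    have : 0 ≤ t := hu0.trans (le_of_lt ht)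
    positivity
  have hlim : Tendsto (fun t : ℝ => -(y * (1 + t ^ 2))⁻¹) atTop (𝓝 0) := by
    rw [← neg_zero]
    refine (tendsto_inv_atTop_zero.comp ?_).neg
    exact (tendsto_atTop_add_const_left _ _ (tendsto_pow_atTop two_ne_zero)).const_mul_atTop hy
  have hInt := integrableOn_Ioi_deriv_of_nonneg' hderiv hpos hlim
  have hval := integral_Ioi_of_hasDerivAt_of_nonneg' hderiv hpos hlim
  rw [hset, lintegral_indicator measurableSet_Ici, Measure.restrict_restrict measurableSet_Ici]
  have hae : (Ici u ∩ Ioi 0 : Set ℝ) =ᵐ[volume] Ioi u := by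
    have h1 : (Ici u ∩ Ioi 0 : Set ℝ) =ᵐ[volume] (Ioi u ∩ Ioi 0 : Set ℝ) :=
      Ioi_ae_eq_Ici.symm.inter (ae_eq_refl _)
    rwa [Ioi_inter_Ioi, sup_eq_left.2 hu0] at h1
  rw [setLIntegral_congr hae, ← ofReal_integral_eq_lintegral_ofReal hInt
    ((ae_restrict_iff' measurableSet_Ioi).2 (Eventually.of_forall hpos)), hval]
  congr 1
  rw [hu, div_pow, sq_abs]
  field_simp
  ring

lemma lintegral_poisson_eq (μ : Measure ℝ) [IsFiniteMeasure μ] (l : ℝ) {y : ℝ} (hy : 0 < y) :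
    ∫⁻ x, ENNReal.ofReal (y / ((x - l) ^ 2 + y ^ 2)) ∂μ =
      ∫⁻ t in Ioi (0 : ℝ), ENNReal.ofReal (4 * t ^ 2 / (1 + t ^ 2) ^ 2) *
        (μ (Metric.closedBall l (y * t)) / volume (Metric.closedBall l (y * t))) := by
  simp_rw [poisson_eq_lintegral_indicator _ l hy]
  rw [lintegral_lintegral_swap]
  · refine setLIntegral_congr_fun measurableSet_Ioi fun t ht => ?_
    have ht : 0 < t := ht
    have h1 : ∀ x : ℝ, {t : ℝ | |x - l| ≤ y * t}.indicator
        (fun t => ENNReal.ofReal (2 * t / (y * (1 + t ^ 2) ^ 2))) t =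
        (Metric.closedBall l (y * t)).indicator
          (fun _ => ENNReal.ofReal (2 * t / (y * (1 + t ^ 2) ^ 2))) x := by
      intro x
      simp only [indicator, mem_ofPred_eq, Metric.mem_closedBall, Real.dist_eq]
    simp only [h1]
    rw [lintegral_indicator_const Metric.isClosed_closedBall.measurableSet, Real.volume_closedBall,
      ENNReal.div_eq_inv_mul, ← mul_assoc]
    congr 1
    rw [← ENNReal.ofReal_inv_of_pos (by positivity), ← ENNReal.ofReal_mul (by positivity)]
    congr 1
    field_simp
    ring
  · refine Measurable.aemeasurable ?_
    have : MeasurableSet {p : ℝ × ℝ | |p.1 - l| ≤ y * p.2} :=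
      measurableSet_le (by fun_prop) (by fun_prop)
    exact Measurable.indicator (f := fun p : ℝ × ℝ =>
      ENNReal.ofReal (2 * p.2 / (y * (1 + p.2 ^ 2) ^ 2))) (by fun_prop) this

lemma lintegral_four_mul_sq_div_sq :
    ∫⁻ t in Ioi (0 : ℝ), ENNReal.ofReal (4 * t ^ 2 / (1 + t ^ 2) ^ 2) = ENNReal.ofReal π := by
  have hderiv : ∀ t ∈ Ici (0 : ℝ), HasDerivAt
      (fun t : ℝ => 2 * Real.arctan t - 2 * (t / (1 + t ^ 2)))
      (4 * t ^ 2 / (1 + t ^ 2) ^ 2) t := by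
    intro t _
    have h1 : HasDerivAt (fun t : ℝ => 1 + t ^ 2) (2 * t) t := by
      simpa using (hasDerivAt_pow 2 t).const_add 1
    refine (((Real.hasDerivAt_arctan t).const_mul 2).sub
      (((hasDerivAt_id t).div h1 (by positivity)).const_mul 2)).congr_deriv ?_
    simp only [id]
    field_simp
    ring
  have hpos : ∀ t ∈ Ioi (0 : ℝ), 0 ≤ 4 * t ^ 2 / (1 + t ^ 2) ^ 2 := by
    intro t _
    positivity
  have hfrac : Tendsto (fun t : ℝ => t / (1 + t ^ 2)) atTop (𝓝 0) := by
    refine squeeze_zero' ?_ ?_ tendsto_inv_atTop_zero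
    · filter_upwards [eventually_gt_atTop 0] with t ht
      positivity
    · filter_upwards [eventually_gt_atTop 0] with t ht
      rw [inv_eq_one_div, div_le_div_iff₀ (by positivity) ht]
      nlinarith
  have hlim : Tendsto (fun t : ℝ => 2 * Real.arctan t - 2 * (t / (1 + t ^ 2))) atTop (𝓝 π) := by
    have h := ((tendsto_nhds_of_tendsto_nhdsWithin Real.tendsto_arctan_atTop).const_mul 2).sub
      (hfrac.const_mul 2)
    convert h using 2
    ring
  rw [← ofReal_integral_eq_lintegral_ofReal (integrableOn_Ioi_deriv_of_nonneg' hderiv hpos hlim)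
    ((ae_restrict_iff' measurableSet_Ioi).2 (Eventually.of_forall hpos)),
    integral_Ioi_of_hasDerivAt_of_nonneg' hderiv hpos hlim]
  simp

lemma exists_bound_measure_closedBall_div_volume (μ : Measure ℝ) [IsFiniteMeasure μ] {l : ℝ}
    {D : ℝ≥0∞} (hD : D ≠ ∞)
    (h : Tendsto (fun r => μ (Metric.closedBall l r) / volume (Metric.closedBall l r))
      (𝓝[>] 0) (𝓝 D)) :
    ∃ M : ℝ≥0∞, M ≠ ∞ ∧
      ∀ r > 0, μ (Metric.closedBall l r) / volume (Metric.closedBall l r) ≤ M := by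
  have h1 := h.eventually (eventually_le_nhds (ENNReal.lt_add_right hD one_ne_zero))
  obtain ⟨r₀, hr₀, hr₀'⟩ := mem_nhdsGT_iff_exists_Ioo_subset.1 h1
  have hr₀ : 0 < r₀ := hr₀
  refine ⟨max (D + 1) (μ univ / ENNReal.ofReal (2 * r₀)), ?_, fun r hr => ?_⟩
  · refine (max_lt (by finiteness) (ENNReal.div_lt_top (by finiteness) ?_)).ne
    simpa using hr₀
  · rcases lt_or_ge r r₀ with hlt | hge
    · exact le_max_of_le_left (hr₀' ⟨hr, hlt⟩)
    · refine le_max_of_le_right ?_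
      rw [Real.volume_closedBall]
      gcongr
      exact subset_univ _

/-- Pointwise Fatou theorem for Poisson integrals in the upper half-plane. -/
lemma tendsto_integral_poisson (μ : Measure ℝ) [IsFiniteMeasure μ] {l : ℝ}
    {D : ℝ≥0∞} (hD : D ≠ ∞)
    (h : Tendsto (fun r => μ (Metric.closedBall l r) / volume (Metric.closedBall l r))
      (𝓝[>] 0) (𝓝 D)) :
    Tendsto (fun y : ℝ => ∫ x, y / ((x - l) ^ 2 + y ^ 2) ∂μ) (𝓝[>] 0) (𝓝 (π * D.toReal)) := by
  obtain ⟨M, hM, hbound⟩ := exists_bound_measure_closedBall_div_volume μ hD h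
  have hmeas : ∀ y : ℝ, 0 < y → Measurable fun t : ℝ =>
      ENNReal.ofReal (4 * t ^ 2 / (1 + t ^ 2) ^ 2) *
        (μ (Metric.closedBall l (y * t)) / volume (Metric.closedBall l (y * t))) := by
    intro y hy
    have hmono : ∀ ν : Measure ℝ, Measurable fun t : ℝ => ν (Metric.closedBall l (y * t)) := by
      intro ν
      refine Monotone.measurable fun a b hab => ?_
      gcongr
    have h1 := hmono μ
    have h2 := hmono volume
    exact Measurable.mul (by fun_prop) (h1.div h2)
  have hlim : Tendsto (fun y : ℝ => ∫⁻ t in Ioi (0 : ℝ),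
      ENNReal.ofReal (4 * t ^ 2 / (1 + t ^ 2) ^ 2) *
        (μ (Metric.closedBall l (y * t)) / volume (Metric.closedBall l (y * t))))
      (𝓝[>] 0) (𝓝 (∫⁻ t in Ioi (0 : ℝ), ENNReal.ofReal (4 * t ^ 2 / (1 + t ^ 2) ^ 2) * D)) := by
    refine tendsto_lintegral_filter_of_dominated_convergence
      (fun t => ENNReal.ofReal (4 * t ^ 2 / (1 + t ^ 2) ^ 2) * M) ?_ ?_ ?_ ?_
    · filter_upwards [self_mem_nhdsWithin] with y hy using hmeas y hy
    · filter_upwards [self_mem_nhdsWithin] with y hy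
      filter_upwards [ae_restrict_mem measurableSet_Ioi] with t ht
      have hyt : 0 < y * t := mul_pos (mem_Ioi.1 hy) (mem_Ioi.1 ht)
      gcongr
      exact hbound _ hyt
    · rw [lintegral_mul_const' _ _ hM, lintegral_four_mul_sq_div_sq]
      finiteness
    · filter_upwards [ae_restrict_mem measurableSet_Ioi] with t ht
      refine ENNReal.Tendsto.const_mul (h.comp ?_) (Or.inr ENNReal.ofReal_ne_top)
      refine tendsto_nhdsWithin_iff.2 ⟨?_, ?_⟩
      · have : Tendsto (fun y : ℝ => y * t) (𝓝 0) (𝓝 (0 * t)) := tendsto_id.mul_const t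
        rw [zero_mul] at this
        exact this.mono_left nhdsWithin_le_nhds
      · filter_upwards [self_mem_nhdsWithin] with y hy
        exact mul_pos (mem_Ioi.1 hy) (mem_Ioi.1 ht)
  rw [lintegral_mul_const' _ _ hD, lintegral_four_mul_sq_div_sq] at hlim
  have h2 := (ENNReal.tendsto_toReal (by finiteness)).comp hlim
  rw [ENNReal.toReal_mul, ENNReal.toReal_ofReal Real.pi_nonneg] at h2
  refine h2.congr' ?_
  filter_upwards [self_mem_nhdsWithin] with y hy
  have hy : 0 < y := hy
  rw [Function.comp_apply, ← lintegral_poisson_eq μ l hy, integral_eq_lintegral_of_nonneg_ae]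
  · exact Eventually.of_forall fun x => by positivity
  · exact Measurable.aestronglyMeasurable (by fun_prop)

lemma integrable_poisson (μ : Measure ℝ) [IsFiniteMeasure μ] (l : ℝ) {y : ℝ} (hy : 0 < y) :
    Integrable (fun x => y / ((x - l) ^ 2 + y ^ 2)) μ := by
  refine Integrable.of_bound (C := 1 / y) (Measurable.aestronglyMeasurable (by fun_prop))
    (Eventually.of_forall fun x => ?_)
  rw [Real.norm_of_nonneg (by positivity), div_le_div_iff₀ (by positivity) hy]
  nlinarith [sq_nonneg (x - l)]

lemma measureReal_closedBall_le_poisson (μ : Measure ℝ) [IsFiniteMeasure μ] (l : ℝ) {y : ℝ}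
    (hy : 0 < y) :
    μ.real (Metric.closedBall l y) ≤ (∫ x, y / ((x - l) ^ 2 + y ^ 2) ∂μ) * (2 * y) := by
  have hnn : ∀ x, 0 ≤ y / ((x - l) ^ 2 + y ^ 2) := fun x => by positivity
  have h1 := mul_meas_ge_le_integral_of_nonneg (Eventually.of_forall hnn)
    (integrable_poisson μ l hy) (2 * y)⁻¹
  have h2 : μ.real (Metric.closedBall l y) ≤
      μ.real {x | (2 * y)⁻¹ ≤ y / ((x - l) ^ 2 + y ^ 2)} := by
    refine measureReal_mono fun x hx => ?_
    rw [Metric.mem_closedBall, Real.dist_eq] at hx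
    have h3 : (x - l) ^ 2 ≤ y ^ 2 := sq_le_sq' (abs_le.1 hx).1 (abs_le.1 hx).2
    rw [mem_ofPred_eq, inv_eq_one_div, div_le_div_iff₀ (by positivity) (by positivity)]
    nlinarith
  rw [inv_mul_le_iff₀ (by positivity)] at h1
  linarith

/-- A finite measure does not charge Lebesgue-null sets of points at which its Poisson integral
stays bounded. -/
lemma measure_eq_zero_of_poisson_bounded (μ : Measure ℝ) [IsFiniteMeasure μ] {s : Set ℝ}
    (hs : volume s = 0)
    (h : ∀ l ∈ s, ∃ C : ℝ, ∀ᶠ y in 𝓝[>] (0 : ℝ), ∫ x, y / ((x - l) ^ 2 + y ^ 2) ∂μ ≤ C) :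
    μ s = 0 := by
  let S : ℕ → Set ℝ := fun n =>
    {l ∈ s | ∀ᶠ y in 𝓝[>] (0 : ℝ), ∫ x, y / ((x - l) ^ 2 + y ^ 2) ∂μ ≤ (n : ℝ)}
  have hcover : s ⊆ ⋃ n, S n := by
    intro l hl
    obtain ⟨C, hC⟩ := h l hl
    obtain ⟨n, hn⟩ := exists_nat_ge C
    exact mem_iUnion.2 ⟨n, hl, hC.mono fun y hy => hy.trans hn⟩
  refine measure_mono_null hcover (measure_iUnion_null fun n => ?_)
  have hle := (Besicovitch.vitaliFamily μ).measure_le_of_frequently_le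
    ((n : NNReal) • (volume : Measure ℝ)) Measure.AbsolutelyContinuous.rfl (S n) ?_
  · have h0 : volume (S n) = 0 := measure_mono_null (fun l hl => hl.1) hs
    simpa [h0] using hle
  · rintro l ⟨-, hl⟩
    refine (Besicovitch.tendsto_filterAt μ l).frequently (Eventually.frequently ?_)
    filter_upwards [hl, self_mem_nhdsWithin] with y hy hy0
    have hy0 : 0 < y := hy0
    have h1 : μ.real (Metric.closedBall l y) ≤ n * (2 * y) :=
      (measureReal_closedBall_le_poisson μ l hy0).trans (by gcongr)
    rw [Measure.smul_apply, Real.volume_closedBall, ← ENNReal.ofReal_toReal (measure_ne_top μ _)]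
    refine (ENNReal.ofReal_le_ofReal h1).trans (le_of_eq ?_)
    rw [ENNReal.ofReal_mul (by positivity), ENNReal.ofReal_natCast]
    rfl

lemma im_integral_inv_sub (μ : Measure ℝ) [IsFiniteMeasure μ] (l : ℝ) {y : ℝ} (hy : 0 < y) :
    (∫ x : ℝ, ((x : ℂ) - (l + y * I))⁻¹ ∂μ).im = ∫ x, y / ((x - l) ^ 2 + y ^ 2) ∂μ := by
  have hint : Integrable (fun x : ℝ => ((x : ℂ) - (l + y * I))⁻¹) μ := by
    refine Integrable.of_bound (C := y⁻¹) (Measurable.aestronglyMeasurable (by fun_prop))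
      (Eventually.of_forall fun x => ?_)
    rw [norm_inv]
    refine inv_anti₀ hy ?_
    simpa [abs_of_pos hy] using abs_im_le_norm ((x : ℂ) - (l + y * I))
  refine (integral_im hint).symm.trans (integral_congr_ae (Eventually.of_forall fun x => ?_))
  simp [Complex.normSq_apply, ← sq]

end PoissonIntegral

section Resolvent

lemma SelfAdjointOperator.norm_resolvent_apply_le (H : SelfAdjointOperator 𝓗) {z : ℂ}
    (hz : z.im ≠ 0) (f : 𝓗) : |z.im| * ‖H.resolvent z f‖ ≤ ‖f‖ := by
  set u : H.domain := ⟨H.resolvent z f, H.resolvent_mem z hz f⟩ with hu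
  have hreq : H.op u - z • (u : 𝓗) = f := H.resolvent_right z hz f
  have him : (⟪(u : 𝓗), H.op u⟫_ℂ).im = 0 := by
    have h := congrArg Complex.im (inner_conj_symm (𝕜 := ℂ) (u : 𝓗) (H.op u))
    rw [H.symmetric u u, conj_im] at h
    linarith
  have hinner : (⟪(u : 𝓗), f⟫_ℂ).im = -(z.im * ‖(u : 𝓗)‖ ^ 2) := by
    rw [← hreq, inner_sub_right, inner_smul_right, inner_self_eq_norm_sq_to_K, sub_im, him]
    simp [← ofReal_pow]
  have hle : |z.im| * ‖(u : 𝓗)‖ ^ 2 ≤ ‖(u : 𝓗)‖ * ‖f‖ := by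
    calc |z.im| * ‖(u : 𝓗)‖ ^ 2 = |(⟪(u : 𝓗), f⟫_ℂ).im| := by
          rw [hinner, abs_neg, abs_mul, abs_of_nonneg (sq_nonneg ‖(u : 𝓗)‖)]
      _ ≤ ‖⟪(u : 𝓗), f⟫_ℂ‖ := abs_im_le_norm _
      _ ≤ ‖(u : 𝓗)‖ * ‖f‖ := norm_inner_le_norm _ _
  change |z.im| * ‖(u : 𝓗)‖ ≤ ‖f‖
  rcases (norm_nonneg (u : 𝓗)).eq_or_lt with h0 | h0
  · rw [← h0, mul_zero]
    exact norm_nonneg f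
  · nlinarith

lemma SelfAdjointOperator.norm_resolvent_le (H : SelfAdjointOperator 𝓗) {z : ℂ}
    (hz : z.im ≠ 0) : ‖H.resolvent z‖ ≤ |z.im|⁻¹ := by
  refine ContinuousLinearMap.opNorm_le_bound _ (by positivity) fun f => ?_
  rw [← div_eq_inv_mul, le_div_iff₀ (abs_pos.2 hz), mul_comm]
  exact H.norm_resolvent_apply_le hz f

/-- The first resolvent identity. -/
lemma SelfAdjointOperator.resolvent_sub_resolvent (H : SelfAdjointOperator 𝓗) {z w : ℂ}
    (hz : z.im ≠ 0) (hw : w.im ≠ 0) :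
    H.resolvent w - H.resolvent z = (w - z) • (H.resolvent z ∘L H.resolvent w) := by
  ext f
  set u : H.domain := ⟨H.resolvent w f, H.resolvent_mem w hw f⟩ with hu
  have hreq : H.op u - w • (u : 𝓗) = f := H.resolvent_right w hw f
  have hleft : H.resolvent z (H.op u - z • (u : 𝓗)) = u := H.resolvent_left z hz u
  have heq : H.op u - z • (u : 𝓗) = f + (w - z) • (u : 𝓗) := by
    rw [← hreq, sub_smul]
    abel
  rw [heq, map_add, map_smul] at hleft
  change (u : 𝓗) - H.resolvent z f = (w - z) • H.resolvent z (u : 𝓗)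
  nth_rewrite 1 [← hleft]
  abel

lemma SelfAdjointOperator.continuous_resolvent_horizontal (H : SelfAdjointOperator 𝓗) {y : ℝ}
    (hy : 0 < y) : Continuous fun l : ℝ => H.resolvent ((l : ℂ) + y * I) := by
  have him : ∀ l : ℝ, ((l : ℂ) + y * I).im = y := fun l => by simp
  have hne : ∀ l : ℝ, ((l : ℂ) + y * I).im ≠ 0 := fun l => by rw [him]; exact hy.ne'
  have hbd : ∀ l : ℝ, ‖H.resolvent ((l : ℂ) + y * I)‖ ≤ y⁻¹ := fun l => by
    simpa only [him, abs_of_pos hy] using H.norm_resolvent_le (hne l)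
  refine LipschitzWith.continuous (K := Real.toNNReal (y⁻¹ * y⁻¹))
    (LipschitzWith.of_dist_le_mul fun a b => ?_)
  rw [Real.coe_toNNReal _ (by positivity), dist_eq_norm,
    H.resolvent_sub_resolvent (hne b) (hne a), norm_smul, mul_comm, add_sub_add_right_eq_sub,
    ← ofReal_sub, norm_real, ← dist_eq_norm]
  gcongr
  refine (ContinuousLinearMap.opNorm_comp_le _ _).trans ?_
  gcongr
  exacts [hbd b, hbd a]

lemma re_inner_imOp (T : 𝓗 →L[ℂ] 𝓗) (f : 𝓗) : (⟪f, imOp T f⟫_ℂ).re = (⟪f, T f⟫_ℂ).im := by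
  have h : ⟪f, ContinuousLinearMap.adjoint T f⟫_ℂ = (starRingEnd ℂ) ⟪f, T f⟫_ℂ := by
    rw [ContinuousLinearMap.adjoint_inner_right, inner_conj_symm]
  simp only [imOp, smul_apply, sub_apply,
    inner_smul_right, inner_sub_right, h, sub_conj]
  have : (2 * I)⁻¹ * (((2 * (⟪f, T f⟫_ℂ).im : ℝ) : ℂ) * I) = ((⟪f, T f⟫_ℂ).im : ℂ) := by
    push_cast
    field_simp
  rw [this, ofReal_re]

lemma inner_Tz (F : 𝓗 →L[ℂ] 𝓚) (H : SelfAdjointOperator 𝓗) (z : ℂ) (k : 𝓚) :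
    ⟪k, Tz F H z k⟫_ℂ =
      ⟪ContinuousLinearMap.adjoint F k, H.resolvent z (ContinuousLinearMap.adjoint F k)⟫_ℂ := by
  rw [ContinuousLinearMap.adjoint_inner_left]
  rfl

lemma mem_LambdaSet_iff (F : 𝓗 →L[ℂ] 𝓚) (H : SelfAdjointOperator 𝓗) (l : ℝ) :
    l ∈ LambdaSet F H ↔ ∀ n : ℕ, ∃ m : ℕ, ∀ a ∈ Ioo (0 : ℝ) (1 / (m + 1)),
      ∀ b ∈ Ioo (0 : ℝ) (1 / (m + 1)),
        dist (Tz F H ((l : ℂ) + a * I)) (Tz F H ((l : ℂ) + b * I)) ≤ 1 / (n + 1) := by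
  change (∃ L, Tendsto _ _ (𝓝 L)) ↔ _
  rw [← cauchy_map_iff_exists_tendsto, Metric.cauchy_iff]
  constructor
  · rintro ⟨-, h⟩ n
    obtain ⟨t, ht, ht'⟩ := h (1 / (n + 1)) (by positivity)
    obtain ⟨r, hr, hr'⟩ := mem_nhdsGT_iff_exists_Ioo_subset.1 (mem_map.1 ht)
    obtain ⟨m, hm⟩ := exists_nat_one_div_lt (mem_Ioi.1 hr)
    exact ⟨m, fun a ha b hb => (ht' _ (hr' ⟨ha.1, ha.2.trans hm⟩) _
      (hr' ⟨hb.1, hb.2.trans hm⟩)).le⟩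
  · refine fun h => ⟨inferInstance, fun ε hε => ?_⟩
    obtain ⟨n, hn⟩ := exists_nat_one_div_lt hε
    obtain ⟨m, hm⟩ := h n
    refine ⟨_, image_mem_map (Ioo_mem_nhdsGT (show (0 : ℝ) < 1 / (m + 1) by positivity)), ?_⟩
    rintro _ ⟨a, ha, rfl⟩ _ ⟨b, hb, rfl⟩
    exact (hm a ha b hb).trans_lt hn

lemma measurableSet_LambdaSet (F : 𝓗 →L[ℂ] 𝓚) (H : SelfAdjointOperator 𝓗) :
    MeasurableSet (LambdaSet F H) := by
  have hset : LambdaSet F H = ⋂ n : ℕ, ⋃ m : ℕ, ⋂ a ∈ Ioo (0 : ℝ) (1 / (m + 1)),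
      ⋂ b ∈ Ioo (0 : ℝ) (1 / (m + 1)),
        {l : ℝ | dist (Tz F H ((l : ℂ) + a * I)) (Tz F H ((l : ℂ) + b * I)) ≤ 1 / (n + 1)} := by
    ext l
    simp only [mem_LambdaSet_iff, mem_iInter, mem_iUnion, mem_ofPred_eq]
  rw [hset]
  refine MeasurableSet.iInter fun n => MeasurableSet.iUnion fun m => IsClosed.measurableSet ?_
  refine isClosed_biInter fun a ha => isClosed_biInter fun b hb => isClosed_le ?_ continuous_const
  have hcont : ∀ y : ℝ, 0 < y → Continuous fun l : ℝ => Tz F H ((l : ℂ) + y * I) := fun y hy =>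
    continuous_const.clm_comp ((H.continuous_resolvent_horizontal hy).clm_comp continuous_const)
  exact (hcont a ha.1).dist (hcont b hb.1)

end Resolvent

section SpectralMeasure

variable {H : SelfAdjointOperator 𝓗} (E : SpectralMeasure H)

lemma SpectralMeasure.norm_proj_sq (f : 𝓗) {s : Set ℝ} (hs : MeasurableSet s) :
    ‖E.proj s f‖ ^ 2 = (E.scalar f).real s := by
  have hidem : E.proj s (E.proj s f) = E.proj s f := by
    have h := congrArg (fun T : 𝓗 →L[ℂ] 𝓗 => T f) (E.proj_mul s s)
    simpa [inter_self] using h.symm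
  have hinner : ⟪E.proj s f, E.proj s f⟫_ℂ = ⟪f, E.proj s f⟫_ℂ := by
    rw [← ContinuousLinearMap.adjoint_inner_right, (E.proj_sa s).adjoint_eq, hidem]
  rw [Measure.real, E.scalar_spec f s hs, ← hinner, inner_self_eq_norm_sq_to_K]
  simp [← ofReal_pow]

lemma SpectralMeasure.im_inner_resolvent (f : 𝓗) (l : ℝ) {y : ℝ} (hy : 0 < y) :
    (⟪f, H.resolvent ((l : ℂ) + y * I) f⟫_ℂ).im =
      ∫ x, y / ((x - l) ^ 2 + y ^ 2) ∂(E.scalar f) := by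
  have := E.scalar_finite f
  rw [E.resolvent_spec _ (by simpa using hy.ne') f, im_integral_inv_sub _ l hy]

lemma denseRange_adjoint_of_injective {F : 𝓗 →L[ℂ] 𝓚} (hF : Function.Injective F) :
    DenseRange (ContinuousLinearMap.adjoint F) := by
  have hker : (LinearMap.range (ContinuousLinearMap.adjoint F).toLinearMap)ᗮ = ⊥ := by
    rw [Submodule.eq_bot_iff]
    intro x hx
    refine hF ((ext_inner_left ℂ fun k => ?_).trans (map_zero F).symm)
    rw [← ContinuousLinearMap.adjoint_inner_left, inner_zero_right]
    exact (Submodule.mem_orthogonal _ _).1 hx _ ⟨k, rfl⟩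
  have h := Submodule.dense_iff_topologicalClosure_eq_top.2
    ((Submodule.topologicalClosure_eq_top_iff).2 hker)
  rwa [LinearMap.coe_range] at h

lemma SpectralMeasure.proj_eq_zero_of_subset_LambdaSet {F : 𝓗 →L[ℂ] 𝓚}
    (hF : Function.Injective F) {s : Set ℝ} (hs : s ⊆ LambdaSet F H) (hsm : MeasurableSet s)
    (hs0 : volume s = 0) : E.proj s = 0 := by
  suffices h : ∀ k, E.proj s (ContinuousLinearMap.adjoint F k) = 0 from
    DFunLike.coe_injective <| (denseRange_adjoint_of_injective hF).equalizer
      (E.proj s).continuous continuous_const (funext h)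
  intro k
  set f := ContinuousLinearMap.adjoint F k with hf
  have := E.scalar_finite f
  have hnull : E.scalar f s = 0 := by
    refine measure_eq_zero_of_poisson_bounded _ hs0 fun l hl => ?_
    obtain ⟨L, hL⟩ := hs hl
    have hlim : Tendsto (fun y : ℝ => (⟪k, Tz F H ((l : ℂ) + y * I) k⟫_ℂ).im) (𝓝[>] 0)
        (𝓝 (⟪k, L k⟫_ℂ).im) :=
      (continuous_im.tendsto _).comp
        (tendsto_const_nhds.inner (((ContinuousLinearMap.apply ℂ 𝓚 k).continuous.tendsto L).comp hL))
    refine ⟨(⟪k, L k⟫_ℂ).im + 1, ?_⟩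
    filter_upwards [hlim.eventually (eventually_le_nhds (lt_add_one _)), self_mem_nhdsWithin]
      with y hy hy0
    rwa [inner_Tz, ← hf, E.im_inner_resolvent f l hy0] at hy
  have hsq := E.norm_proj_sq f hsm
  rw [Measure.real, hnull] at hsq
  simpa using hsq

lemma SpectralMeasure.scalar_restrict_LambdaSet_ac {F : 𝓗 →L[ℂ] 𝓚}
    (hF : Function.Injective F) (f : 𝓗) :
    (E.scalar f).restrict (LambdaSet F H) ≪ volume := by
  have := E.scalar_finite f
  refine Measure.AbsolutelyContinuous.mk fun s hs hs0 => ?_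
  have hm := hs.inter (measurableSet_LambdaSet F H)
  have h := E.norm_proj_sq f hm
  rw [E.proj_eq_zero_of_subset_LambdaSet hF inter_subset_right hm
    (measure_mono_null inter_subset_left hs0)] at h
  rw [Measure.restrict_apply hs, ← measureReal_eq_zero_iff, ← h]
  simp

end SpectralMeasure

/-- For a self-adjoint `H` and a rigging `F`, the spectral measure of
`H` is purely absolutely continuous on `Λ(H,F)`, and for every `f`,
`(1/π) ∫_{Λ(H,F)} lim_{y→0⁺} ⟨f, Im R_{l+iy}(H) f⟩ dl = ‖E(Λ(H,F)) f‖²`. -/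
theorem spectral_measure_purely_ac_on_LambdaSet
    (𝓗 𝓚 : Type) [NormedAddCommGroup 𝓗] [InnerProductSpace ℂ 𝓗] [CompleteSpace 𝓗]
    [TopologicalSpace.SeparableSpace 𝓗]
    [NormedAddCommGroup 𝓚] [InnerProductSpace ℂ 𝓚] [CompleteSpace 𝓚]
    (H : SelfAdjointOperator 𝓗) (E : SpectralMeasure H)
    (F : 𝓗 →L[ℂ] 𝓚) (hF : IsRigging F) :
    -- `E` is purely absolutely continuous on `Λ(H,F)`:
    (∀ s : Set ℝ, s ⊆ LambdaSet F H → MeasurableSet s →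
      MeasureTheory.volume s = 0 → E.proj s = 0) ∧
    -- the limit exists a.e. on `Λ(H,F)` and integrates to `‖E(Λ(H,F)) f‖²`:
    ∀ f : 𝓗, ∃ g : ℝ → ℝ,
      (∀ᵐ l : ℝ ∂(MeasureTheory.volume.restrict (LambdaSet F H)),
        Tendsto
          (fun y : ℝ =>
            (⟪f, imOp (H.resolvent ((l : ℂ) + y * Complex.I)) f⟫_ℂ).re)
          (𝓝[>] (0:ℝ)) (𝓝 (g l))) ∧
      π⁻¹ * (∫ l in LambdaSet F H, g l) = ‖E.proj (LambdaSet F H) f‖ ^ 2 := by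
  refine ⟨fun s hs hsm hs0 => E.proj_eq_zero_of_subset_LambdaSet hF.1 hs hsm hs0, fun f => ?_⟩
  have := E.scalar_finite f
  have hΛ := measurableSet_LambdaSet F H
  refine ⟨fun l => π * ((E.scalar f).rnDeriv volume l).toReal, ?_, ?_⟩
  · refine ae_restrict_of_ae ?_
    filter_upwards [Besicovitch.ae_tendsto_rnDeriv (E.scalar f) volume,
      (E.scalar f).rnDeriv_lt_top volume] with l hl hfin
    refine (tendsto_integral_poisson (E.scalar f) hfin.ne hl).congr' ?_
    filter_upwards [self_mem_nhdsWithin] with y hy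
    rw [re_inner_imOp, E.im_inner_resolvent f l hy]
  · have hint : ∫ l in LambdaSet F H, ((E.scalar f).rnDeriv volume l).toReal =
        (E.scalar f).real (LambdaSet F H) := by
      have h := Measure.setIntegral_toReal_rnDeriv
        (E.scalar_restrict_LambdaSet_ac hF.1 f) (LambdaSet F H)
      rw [measureReal_restrict_apply hΛ, inter_self] at h
      rw [← h]
      refine setIntegral_congr_ae hΛ ?_
      filter_upwards [Measure.rnDeriv_restrict (E.scalar f) volume hΛ] with l hl hmem
      rw [hl, indicator_of_mem hmem]
    rw [integral_const_mul, hint, E.norm_proj_sq f hΛ, inv_mul_cancel_left₀ Real.pi_ne_zero]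

end SSF
end
end

section
/- Let F : ℋ → 𝒦 be a rigging operator and let H_0, H_1, H_2 be self-adjoint operators on ℋ whose pairwise differences belong to F*ℬ_sa(𝒦)F. Then for every λ ∈ Λ(H_0, F) ∩ Λ(H_1, F) ∩ Λ(H_2, F) the wave matrices satisfy the multiplicative property w_±(λ; H_2, H_0) = w_±(λ; H_2, H_1) w_±(λ; H_1, H_0). Moreover, each wave matrix w_±(λ; H_1, H_0) : 𝔥_λ(H_0) → 𝔥_λ(H_1) is unitary, w_±(λ; H_0, H_0) = 1, and w_±(λ; H_1, H_0)* = w_±(λ; H_0, H_1). -/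
open MeasureTheory Filter Complex Set Topology
open scoped InnerProductSpace ComplexInnerProductSpace ENNReal Topology Real
set_option autoImplicit false

noncomputable section

namespace SSF

variable {𝓗 : Type*} {𝓚 : Type*}

variable [NormedAddCommGroup 𝓗] [InnerProductSpace ℂ 𝓗] [CompleteSpace 𝓗]
variable [NormedAddCommGroup 𝓚] [InnerProductSpace ℂ 𝓚] [CompleteSpace 𝓚]

/-- The fibre Hilbert space `𝔥_λ(H)`: the closure of the range of
`Q = √(Im T_{λ+i0}(H))`. -/
def fibSpace (Q : 𝓚 →L[ℂ] 𝓚) : Submodule ℂ 𝓚 :=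
  (LinearMap.range (Q : 𝓚 →ₗ[ℂ] 𝓚)).topologicalClosure

/-- The element `Q ψ` of the fibre space. -/
def toFib (Q : 𝓚 →L[ℂ] 𝓚) (ψ : 𝓚) : fibSpace Q :=
  ⟨Q ψ, Submodule.le_topologicalClosure _ (LinearMap.mem_range_self _ ψ)⟩

/-- `Q`, corestricted to the fibre space. -/
def codToFib (Q : 𝓚 →L[ℂ] 𝓚) : 𝓚 →L[ℂ] (fibSpace Q) :=
  Q.codRestrict (fibSpace Q) fun ψ =>
    Submodule.le_topologicalClosure _ (LinearMap.mem_range_self _ ψ)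

/-- `Q` is the positive square root of `Im T_{l+i0}(H)`. -/
def IsSqrtImT (F : 𝓗 →L[ℂ] 𝓚) (H : SelfAdjointOperator 𝓗) (l : ℝ)
    (Q : 𝓚 →L[ℂ] 𝓚) : Prop :=
  IsSelfAdjoint Q ∧ (∀ ψ : 𝓚, 0 ≤ (⟪ψ, Q ψ⟫_ℂ).re) ∧ Q ∘L Q = imOp (Tlim F H l)

/-- The defining property of the wave matrix `w_±(l; H₁, H₀)` (`ε = 1` for `w₊`,
`ε = -1` for `w₋`), given positive square roots `Q₁, Q₀` of `Im T_{l+i0}(H₁)`,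
`Im T_{l+i0}(H₀)`: it is a contraction `𝔥_l(H₀) → 𝔥_l(H₁)` determined by
`⟪𝔈_l(H₁)f, w_± 𝔈_l(H₀)g⟫ = lim_{y→0⁺} (y/π)⟪R_{l±iy}(H₁)f, R_{l±iy}(H₀)g⟫`
for `f, g ∈ ran F*`. -/
def IsWaveMatrix (F : 𝓗 →L[ℂ] 𝓚) (H₁ H₀ : SelfAdjointOperator 𝓗)
    (Q₁ Q₀ : 𝓚 →L[ℂ] 𝓚) (l : ℝ) (ε : ℝ)
    (w : fibSpace Q₀ →L[ℂ] fibSpace Q₁) : Prop :=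
  ‖w‖ ≤ 1 ∧ ∀ φ ψ : 𝓚,
    Tendsto (fun y : ℝ =>
        (y : ℂ) * ⟪H₁.resolvent ((l : ℂ) + (ε : ℂ) * y * Complex.I)
            (ContinuousLinearMap.adjoint F φ),
          H₀.resolvent ((l : ℂ) + (ε : ℂ) * y * Complex.I)
            (ContinuousLinearMap.adjoint F ψ)⟫_ℂ)
      (𝓝[>] (0:ℝ)) (𝓝 ⟪Q₁ φ, ((w (toFib Q₀ ψ)) : 𝓚)⟫_ℂ)

/-- Pointwise application of an `L²` element (via its canonical representative). -/
def lpApply {μ : Measure ℝ} (g : MeasureTheory.Lp 𝓚 2 μ) (l : ℝ) : 𝓚 :=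
  (g : ℝ →ₘ[μ] 𝓚) l

theorem SelfAdjointOperator.adjoint_resolvent (H : SelfAdjointOperator 𝓗) {z : ℂ}
    (hz : z.im ≠ 0) :
    ContinuousLinearMap.adjoint (H.resolvent z) = H.resolvent (starRingEnd ℂ z) := by
  have hz' : (starRingEnd ℂ z).im ≠ 0 := by simpa using hz
  symm
  rw [ContinuousLinearMap.eq_adjoint_iff]
  intro f g
  have hf := H.resolvent_right _ hz' f
  have hg := H.resolvent_right z hz g
  have hs := H.symmetric ⟨_, H.resolvent_mem _ hz' f⟩ ⟨_, H.resolvent_mem z hz g⟩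
  conv_lhs => rw [← hg]
  conv_rhs => rw [← hf]
  simp only [inner_sub_left, inner_sub_right, inner_smul_left, inner_smul_right,
    Complex.conj_conj] at hs ⊢
  rw [hs]

/-- The first resolvent identity `R_z - R_{z̄} = (z - z̄) R_{z̄} R_z`. -/
theorem SelfAdjointOperator.resolvent_sub_resolvent_conj (H : SelfAdjointOperator 𝓗) {z : ℂ}
    (hz : z.im ≠ 0) (f : 𝓗) :
    H.resolvent z f - H.resolvent (starRingEnd ℂ z) f =
      (z - starRingEnd ℂ z) • H.resolvent (starRingEnd ℂ z) (H.resolvent z f) := by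
  have hz' : (starRingEnd ℂ z).im ≠ 0 := by simpa using hz
  have h1 := H.resolvent_left _ hz' ⟨_, H.resolvent_mem z hz f⟩
  have h2 : H.op ⟨_, H.resolvent_mem z hz f⟩ = f + z • H.resolvent z f :=
    eq_add_of_sub_eq (H.resolvent_right z hz f)
  simp only [h2, map_sub, map_add, map_smul] at h1
  conv_lhs => rw [← h1]
  module

theorem adjoint_Tz (F : 𝓗 →L[ℂ] 𝓚) (H : SelfAdjointOperator 𝓗) {z : ℂ} (hz : z.im ≠ 0) :
    ContinuousLinearMap.adjoint (Tz F H z) = Tz F H (starRingEnd ℂ z) := by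
  simp only [Tz, ContinuousLinearMap.adjoint_comp, ContinuousLinearMap.adjoint_adjoint,
    H.adjoint_resolvent hz, ContinuousLinearMap.comp_assoc]

/-- `Im z ⟪R_z F* φ, R_z F* ψ⟫ = ⟪φ, Im T_z ψ⟫`. -/
theorem im_mul_inner_resolvent (F : 𝓗 →L[ℂ] 𝓚) (H : SelfAdjointOperator 𝓗) {z : ℂ}
    (hz : z.im ≠ 0) (φ ψ : 𝓚) :
    (z.im : ℂ) * ⟪H.resolvent z (ContinuousLinearMap.adjoint F φ),
        H.resolvent z (ContinuousLinearMap.adjoint F ψ)⟫_ℂ = ⟪φ, imOp (Tz F H z) ψ⟫_ℂ := by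
  have h := H.resolvent_sub_resolvent_conj hz (ContinuousLinearMap.adjoint F ψ)
  have key : imOp (Tz F H z) ψ = (z.im : ℂ) • F (H.resolvent (starRingEnd ℂ z)
      (H.resolvent z (ContinuousLinearMap.adjoint F ψ))) := by
    simp only [imOp, adjoint_Tz F H hz]
    simp only [Tz, smul_apply, sub_apply,
      ContinuousLinearMap.comp_apply]
    rw [← map_sub, h, map_smul, smul_smul, Complex.sub_conj]
    congr 1
    push_cast
    field_simp
  rw [key, inner_smul_right, ← ContinuousLinearMap.adjoint_inner_left F,
    ← H.adjoint_resolvent hz, ContinuousLinearMap.adjoint_inner_right]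

theorem IsSum.resolvent_eq {H₀ H₁ : SelfAdjointOperator 𝓗} {V : 𝓗 →L[ℂ] 𝓗}
    (h : IsSum H₀ V H₁) {z : ℂ} (hz : z.im ≠ 0) (f : 𝓗) :
    H₀.resolvent z f = H₁.resolvent z (f + V (H₀.resolvent z f)) := by
  have h1 := DFunLike.congr_fun (h z hz) f
  simp only [sub_apply, neg_apply, ContinuousLinearMap.comp_apply] at h1
  rw [map_add, sub_eq_iff_eq_add.mp h1]
  abel

theorem IsSum.symm {H₀ H₁ : SelfAdjointOperator 𝓗} {V : 𝓗 →L[ℂ] 𝓗}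
    (hV : IsSelfAdjoint V) (h : IsSum H₀ V H₁) : IsSum H₁ (-V) H₀ := by
  intro z hz
  have hz' : (starRingEnd ℂ z).im ≠ 0 := by simpa using hz
  have h1 := congrArg ContinuousLinearMap.adjoint (h _ hz')
  rw [map_sub, map_neg, ContinuousLinearMap.adjoint_comp, ContinuousLinearMap.adjoint_comp,
    hV.adjoint_eq, H₀.adjoint_resolvent hz', H₁.adjoint_resolvent hz', Complex.conj_conj] at h1
  rw [← neg_sub, h1]
  ext f
  simp

theorem isSelfAdjoint_sandwich (F : 𝓗 →L[ℂ] 𝓚) {J : 𝓚 →L[ℂ] 𝓚} (hJ : IsSelfAdjoint J) :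
    IsSelfAdjoint (sandwich F J) := by
  rw [ContinuousLinearMap.isSelfAdjoint_iff']
  simp only [sandwich, ContinuousLinearMap.adjoint_comp, ContinuousLinearMap.adjoint_adjoint,
    hJ.adjoint_eq, ContinuousLinearMap.comp_assoc]

theorem sandwich_neg (F : 𝓗 →L[ℂ] 𝓚) (J : 𝓚 →L[ℂ] 𝓚) : sandwich F (-J) = -sandwich F J := by
  ext f
  simp [sandwich]

/-- `R_z(H₀) F* = R_z(H₁) F* (1 + J T_z(H₀))`. -/
theorem IsSum.resolvent_adjoint_eq {F : 𝓗 →L[ℂ] 𝓚} {H₀ H₁ : SelfAdjointOperator 𝓗}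
    {J : 𝓚 →L[ℂ] 𝓚} (h : IsSum H₀ (sandwich F J) H₁) {z : ℂ} (hz : z.im ≠ 0) (ψ : 𝓚) :
    H₀.resolvent z (ContinuousLinearMap.adjoint F ψ) =
      H₁.resolvent z (ContinuousLinearMap.adjoint F (ψ + J (Tz F H₀ z ψ))) := by
  rw [h.resolvent_eq hz, map_add (ContinuousLinearMap.adjoint F)]
  rfl

/-- `T` is the boundary value `T_{l + iε0}(H)`, whose imaginary part is `ε Q²`. -/
structure IsBoundaryValue (F : 𝓗 →L[ℂ] 𝓚) (H : SelfAdjointOperator 𝓗) (l ε : ℝ)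
    (Q T : 𝓚 →L[ℂ] 𝓚) : Prop where
  tendsto : Tendsto (fun y : ℝ => Tz F H ((l : ℂ) + (ε : ℂ) * y * Complex.I)) (𝓝[>] 0) (𝓝 T)
  isSelfAdjoint : IsSelfAdjoint Q
  imOp_eq : imOp T = (ε : ℂ) • (Q ∘L Q)

theorem continuous_imOp : Continuous (imOp : (𝓚 →L[ℂ] 𝓚) → (𝓚 →L[ℂ] 𝓚)) :=
  (continuous_id.fun_sub (ContinuousLinearMap.adjoint : (𝓚 →L[ℂ] 𝓚) ≃ₗᵢ⋆[ℂ] _).continuous).fun_const_smul _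

theorem inner_imOp_eq_im_inner (T : 𝓚 →L[ℂ] 𝓚) (ψ : 𝓚) :
    ⟪ψ, imOp T ψ⟫_ℂ = ((⟪ψ, T ψ⟫_ℂ).im : ℂ) := by
  have h : ⟪T ψ, ψ⟫_ℂ = starRingEnd ℂ ⟪ψ, T ψ⟫_ℂ := (inner_conj_symm _ _).symm
  simp only [imOp, smul_apply, sub_apply, inner_smul_right, inner_sub_right,
    ContinuousLinearMap.adjoint_inner_right]
  rw [h, Complex.sub_conj]
  push_cast
  field_simp

theorem exists_isBoundaryValue {F : 𝓗 →L[ℂ] 𝓚} {H : SelfAdjointOperator 𝓗} {l ε : ℝ}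
    {Q : 𝓚 →L[ℂ] 𝓚} (hl : l ∈ LambdaSet F H) (hQ : IsSqrtImT F H l Q)
    (hε : ε = 1 ∨ ε = -1) : ∃ T, IsBoundaryValue F H l ε Q T := by
  have hT : Tendsto (fun y : ℝ => Tz F H ((l : ℂ) + y * Complex.I)) (𝓝[>] 0)
      (𝓝 (Tlim F H l)) := tendsto_nhds_limUnder hl
  obtain ⟨hsa, -, hsq⟩ := hQ
  rcases hε with rfl | rfl
  · refine ⟨Tlim F H l, ?_, hsa, ?_⟩
    · simpa using hT
    · simp [hsq]
  · refine ⟨ContinuousLinearMap.adjoint (Tlim F H l), ?_, hsa, ?_⟩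
    · refine ((ContinuousLinearMap.adjoint :
        (𝓚 →L[ℂ] 𝓚) ≃ₗᵢ⋆[ℂ] _).continuous.tendsto _ |>.comp hT).congr' ?_
      filter_upwards [self_mem_nhdsWithin] with y hy
      have hy : 0 < y := hy
      rw [Function.comp_apply, adjoint_Tz F H (by simpa using hy.ne')]
      congr 1
      simp
    · rw [hsq]
      simp only [imOp, ContinuousLinearMap.adjoint_adjoint]
      push_cast
      module

theorem tendsto_apply {𝓚 : Type*} [NormedAddCommGroup 𝓚] [InnerProductSpace ℂ 𝓚]
    {α : Type*} {lf : Filter α} {A : α → 𝓚 →L[ℂ] 𝓚} {A' : 𝓚 →L[ℂ] 𝓚}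
    {x : α → 𝓚} {x' : 𝓚} (hA : Tendsto A lf (𝓝 A')) (hx : Tendsto x lf (𝓝 x')) :
    Tendsto (fun a => A a (x a)) lf (𝓝 (A' x')) :=
  (isBoundedBilinearMap_apply.continuous.tendsto (A', x')).comp (hA.prodMk_nhds hx)

namespace IsBoundaryValue

variable {F : 𝓗 →L[ℂ] 𝓚} {H H₀ H₁ : SelfAdjointOperator 𝓗} {l ε : ℝ}
  {J Q T Q₀ T₀ Q₁ T₁ : 𝓚 →L[ℂ] 𝓚}

theorem im_inner (h : IsBoundaryValue F H l ε Q T) (ψ : 𝓚) :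
    (⟪ψ, T ψ⟫_ℂ).im = ε * ‖Q ψ‖ ^ 2 := by
  have h1 := inner_imOp_eq_im_inner T ψ
  have h2 : ⟪ψ, Q (Q ψ)⟫_ℂ = (‖Q ψ‖ : ℂ) ^ 2 := by
    rw [← ContinuousLinearMap.adjoint_inner_left, h.isSelfAdjoint.adjoint_eq,
      inner_self_eq_norm_sq_to_K]
    rfl
  rw [h.imOp_eq] at h1
  simp only [smul_apply, ContinuousLinearMap.comp_apply, inner_smul_right, h2] at h1
  exact_mod_cast h1.symm

theorem apply_eq_zero (h : IsBoundaryValue F H l ε Q T) (hε : ε = 1 ∨ ε = -1) {ψ : 𝓚}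
    (hψ : T ψ = 0) : Q ψ = 0 := by
  have h1 := (h.im_inner ψ).symm
  rw [hψ, inner_zero_right] at h1
  rcases hε with rfl | rfl <;> simpa using h1

/-- `T(H₀) = T(H₁) (1 + J T(H₀))` at the boundary. -/
theorem apply_eq (h₀ : IsBoundaryValue F H₀ l ε Q₀ T₀) (h₁ : IsBoundaryValue F H₁ l ε Q₁ T₁)
    (hε : ε = 1 ∨ ε = -1) (h : IsSum H₀ (sandwich F J) H₁) (ψ : 𝓚) :
    T₁ (ψ + J (T₀ ψ)) = T₀ ψ := by
  have t₀ := tendsto_apply h₀.tendsto (tendsto_const_nhds (x := ψ))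
  have t₁ := tendsto_apply h₁.tendsto
    ((tendsto_const_nhds (x := ψ)).add ((J.continuous.tendsto _).comp t₀))
  refine tendsto_nhds_unique (t₁.congr' ?_) t₀
  filter_upwards [self_mem_nhdsWithin] with y hy
  have hy : 0 < y := hy
  have hz : ((l : ℂ) + (ε : ℂ) * y * Complex.I).im ≠ 0 := by
    rcases hε with rfl | rfl <;> simpa using hy.ne'
  exact congrArg F (h.resolvent_adjoint_eq hz ψ).symm

theorem norm_apply_eq (h₀ : IsBoundaryValue F H₀ l ε Q₀ T₀)
    (h₁ : IsBoundaryValue F H₁ l ε Q₁ T₁) (hε : ε = 1 ∨ ε = -1) (hJ : IsSelfAdjoint J)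
    (h : IsSum H₀ (sandwich F J) H₁) (ψ : 𝓚) : ‖Q₁ (ψ + J (T₀ ψ))‖ = ‖Q₀ ψ‖ := by
  have e := h₁.im_inner (ψ + J (T₀ ψ))
  have hJ' : (⟪J (T₀ ψ), T₀ ψ⟫_ℂ).im = 0 := by
    rw [← Complex.conj_eq_iff_im, inner_conj_symm, ← ContinuousLinearMap.adjoint_inner_left,
      hJ.adjoint_eq]
  rw [h₀.apply_eq h₁ hε h, inner_add_left, Complex.add_im, hJ', add_zero, h₀.im_inner] at e
  have hε' : ε ≠ 0 := by rcases hε with rfl | rfl <;> norm_num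
  exact ((sq_eq_sq₀ (norm_nonneg _) (norm_nonneg _)).mp (mul_left_cancel₀ hε' e)).symm

/-- The limit defining the wave matrix equals `Q₁² (1 + J T(H₀))`. -/
theorem tendsto_inner_resolvent (h₀ : IsBoundaryValue F H₀ l ε Q₀ T₀)
    (h₁ : IsBoundaryValue F H₁ l ε Q₁ T₁) (hε : ε = 1 ∨ ε = -1)
    (h : IsSum H₀ (sandwich F J) H₁) (φ ψ : 𝓚) :
    Tendsto (fun y : ℝ =>
        (y : ℂ) * ⟪H₁.resolvent ((l : ℂ) + (ε : ℂ) * y * Complex.I)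
            (ContinuousLinearMap.adjoint F φ),
          H₀.resolvent ((l : ℂ) + (ε : ℂ) * y * Complex.I)
            (ContinuousLinearMap.adjoint F ψ)⟫_ℂ)
      (𝓝[>] (0:ℝ)) (𝓝 ⟪Q₁ φ, Q₁ (ψ + J (T₀ ψ))⟫_ℂ) := by
  have hεε : (ε : ℂ) * ε = 1 := by rcases hε with rfl | rfl <;> norm_num
  have t₀ := tendsto_apply h₀.tendsto (tendsto_const_nhds (x := ψ))
  have tψ := (tendsto_const_nhds (x := ψ)).add ((J.continuous.tendsto _).comp t₀)
  have t₁ := tendsto_apply ((continuous_imOp.tendsto _).comp h₁.tendsto) tψ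
  have t := ((tendsto_const_nhds (x := φ)).inner (𝕜 := ℂ) t₁).const_mul (ε : ℂ)
  have lim : (ε : ℂ) * ⟪φ, imOp T₁ (ψ + J (T₀ ψ))⟫_ℂ = ⟪Q₁ φ, Q₁ (ψ + J (T₀ ψ))⟫_ℂ := by
    rw [h₁.imOp_eq, smul_apply, inner_smul_right, ← mul_assoc, hεε, one_mul,
      ContinuousLinearMap.comp_apply, ← ContinuousLinearMap.adjoint_inner_left,
      h₁.isSelfAdjoint.adjoint_eq]
  rw [lim] at t
  refine t.congr' ?_
  filter_upwards [self_mem_nhdsWithin] with y hy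
  have hy : 0 < y := hy
  have hz : ((l : ℂ) + (ε : ℂ) * y * Complex.I).im ≠ 0 := by
    rcases hε with rfl | rfl <;> simpa using hy.ne'
  have him : (((l : ℂ) + (ε : ℂ) * y * Complex.I).im : ℂ) = ε * y := by simp
  rw [h.resolvent_adjoint_eq hz ψ]
  simp only [Function.comp_apply]
  rw [← im_mul_inner_resolvent F H₁ hz, him, ← mul_assoc, ← mul_assoc, hεε, one_mul]

end IsBoundaryValue

theorem denseRange_toFib {𝓚 : Type*} [NormedAddCommGroup 𝓚] [InnerProductSpace ℂ 𝓚]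
    (Q : 𝓚 →L[ℂ] 𝓚) : DenseRange (toFib Q) := by
  intro u
  rw [Topology.IsInducing.subtypeVal.closure_eq_preimage_closure_image, ← Set.range_comp]
  exact u.2

theorem fibSpace_ext {𝓚 : Type*} [NormedAddCommGroup 𝓚] [InnerProductSpace ℂ 𝓚]
    (Q : 𝓚 →L[ℂ] 𝓚) {v v' : fibSpace Q}
    (h : ∀ φ, ⟪Q φ, (v : 𝓚)⟫_ℂ = ⟪Q φ, (v' : 𝓚)⟫_ℂ) : v = v' :=
  (denseRange_toFib Q).eq_of_inner_right ℂ h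

/-- The stationary formula `w Q₀ = Q₁ (1 + J T(H₀))` for the wave matrix. -/
theorem IsWaveMatrix.apply_toFib {F : 𝓗 →L[ℂ] 𝓚} {H₀ H₁ : SelfAdjointOperator 𝓗} {l ε : ℝ}
    {J Q₀ T₀ Q₁ T₁ : 𝓚 →L[ℂ] 𝓚} {w : fibSpace Q₀ →L[ℂ] fibSpace Q₁}
    (hw : IsWaveMatrix F H₁ H₀ Q₁ Q₀ l ε w) (h₀ : IsBoundaryValue F H₀ l ε Q₀ T₀)
    (h₁ : IsBoundaryValue F H₁ l ε Q₁ T₁) (hε : ε = 1 ∨ ε = -1)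
    (h : IsSum H₀ (sandwich F J) H₁) (ψ : 𝓚) :
    w (toFib Q₀ ψ) = toFib Q₁ (ψ + J (T₀ ψ)) :=
  fibSpace_ext Q₁ fun φ =>
    tendsto_nhds_unique (hw.2 φ ψ) (h₀.tendsto_inner_resolvent h₁ hε h φ ψ)

theorem IsWaveMatrix.norm_apply {F : 𝓗 →L[ℂ] 𝓚} {H₀ H₁ : SelfAdjointOperator 𝓗} {l ε : ℝ}
    {J Q₀ T₀ Q₁ T₁ : 𝓚 →L[ℂ] 𝓚} {w : fibSpace Q₀ →L[ℂ] fibSpace Q₁}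
    (hw : IsWaveMatrix F H₁ H₀ Q₁ Q₀ l ε w) (h₀ : IsBoundaryValue F H₀ l ε Q₀ T₀)
    (h₁ : IsBoundaryValue F H₁ l ε Q₁ T₁) (hε : ε = 1 ∨ ε = -1) (hJ : IsSelfAdjoint J)
    (h : IsSum H₀ (sandwich F J) H₁) (u : fibSpace Q₀) : ‖w u‖ = ‖u‖ := by
  refine congrFun ((denseRange_toFib Q₀).equalizer (g := fun u => ‖w u‖) (h := fun u => ‖u‖)
    w.continuous.norm continuous_norm (funext fun ψ => ?_)) u
  simp only [Function.comp_apply, hw.apply_toFib h₀ h₁ hε h]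
  exact h₀.norm_apply_eq h₁ hε hJ h ψ

theorem IsWaveMatrix.inner_apply {F : 𝓗 →L[ℂ] 𝓚} {H₀ H₁ : SelfAdjointOperator 𝓗} {l ε : ℝ}
    {Q₀ Q₁ : 𝓚 →L[ℂ] 𝓚} {w : fibSpace Q₀ →L[ℂ] fibSpace Q₁}
    {w' : fibSpace Q₁ →L[ℂ] fibSpace Q₀} (hw : IsWaveMatrix F H₁ H₀ Q₁ Q₀ l ε w)
    (hw' : IsWaveMatrix F H₀ H₁ Q₀ Q₁ l ε w') (u : fibSpace Q₀) (v : fibSpace Q₁) :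
    ⟪w u, v⟫_ℂ = ⟪u, w' v⟫_ℂ := by
  refine (denseRange_toFib Q₀).induction_on (p := fun u => ⟪w u, v⟫_ℂ = ⟪u, w' v⟫_ℂ) u
    (isClosed_eq (by fun_prop) (by fun_prop)) fun ψ => ?_
  refine (denseRange_toFib Q₁).induction_on
    (p := fun v => ⟪w (toFib Q₀ ψ), v⟫_ℂ = ⟪toFib Q₀ ψ, w' v⟫_ℂ) v
    (isClosed_eq (by fun_prop) (by fun_prop)) fun φ => ?_
  have t := (Complex.continuous_conj.tendsto _).comp (hw.2 φ ψ)
  have e := tendsto_nhds_unique (t.congr fun y => ?_) (hw'.2 ψ φ)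
  · rw [inner_conj_symm] at e
    exact e
  · simp only [Function.comp_apply, map_mul, Complex.conj_ofReal, inner_conj_symm]

/-- The wave matrices satisfy the multiplicative property
`w_±(l; H₂, H₀) = w_±(l; H₂, H₁) w_±(l; H₁, H₀)`, are unitary, satisfy
`w_±(l; H₀, H₀) = 1` and `w_±(l; H₁, H₀)* = w_±(l; H₀, H₁)`. -/
theorem wave_matrices_multiplicative_unitary
    (𝓗 𝓚 : Type) [NormedAddCommGroup 𝓗] [InnerProductSpace ℂ 𝓗] [CompleteSpace 𝓗]
    [NormedAddCommGroup 𝓚] [InnerProductSpace ℂ 𝓚] [CompleteSpace 𝓚]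
    (F : 𝓗 →L[ℂ] 𝓚) (hF : IsRigging F)
    (H₀ H₁ H₂ : SelfAdjointOperator 𝓗)
    (J₁₀ J₂₁ J₂₀ : 𝓚 →L[ℂ] 𝓚)
    (hJ₁₀ : IsSelfAdjoint J₁₀) (hJ₂₁ : IsSelfAdjoint J₂₁) (hJ₂₀ : IsSelfAdjoint J₂₀)
    (h10 : IsSum H₀ (sandwich F J₁₀) H₁)
    (h21 : IsSum H₁ (sandwich F J₂₁) H₂)
    (h20 : IsSum H₀ (sandwich F J₂₀) H₂)
    (l : ℝ) (hl0 : l ∈ LambdaSet F H₀) (hl1 : l ∈ LambdaSet F H₁)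
    (hl2 : l ∈ LambdaSet F H₂)
    (Q₀ Q₁ Q₂ : 𝓚 →L[ℂ] 𝓚)
    (hQ₀ : IsSqrtImT F H₀ l Q₀) (hQ₁ : IsSqrtImT F H₁ l Q₁)
    (hQ₂ : IsSqrtImT F H₂ l Q₂)
    (ε : ℝ) (hε : ε = 1 ∨ ε = -1)
    -- the wave matrices for the three pairs, and in the reversed direction
    (w₁₀ : fibSpace Q₀ →L[ℂ] fibSpace Q₁) (w₂₁ : fibSpace Q₁ →L[ℂ] fibSpace Q₂)
    (w₂₀ : fibSpace Q₀ →L[ℂ] fibSpace Q₂) (w₀₁ : fibSpace Q₁ →L[ℂ] fibSpace Q₀)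
    (hw₁₀ : IsWaveMatrix F H₁ H₀ Q₁ Q₀ l ε w₁₀)
    (hw₂₁ : IsWaveMatrix F H₂ H₁ Q₂ Q₁ l ε w₂₁)
    (hw₂₀ : IsWaveMatrix F H₂ H₀ Q₂ Q₀ l ε w₂₀)
    (hw₀₁ : IsWaveMatrix F H₀ H₁ Q₀ Q₁ l ε w₀₁) :
    -- the multiplicative property
    w₂₀ = w₂₁ ∘L w₁₀ ∧
    -- unitarity of the wave matrices
    (∀ u : fibSpace Q₀, ‖w₁₀ u‖ = ‖u‖) ∧ Function.Surjective w₁₀ ∧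
    -- `w_±(l; H₀, H₀) = 1`
    (∀ w₀₀ : fibSpace Q₀ →L[ℂ] fibSpace Q₀,
      IsWaveMatrix F H₀ H₀ Q₀ Q₀ l ε w₀₀ → ∀ u : fibSpace Q₀, w₀₀ u = u) ∧
    -- `w_±(l; H₁, H₀)* = w_±(l; H₀, H₁)`
    (∀ (u : fibSpace Q₀) (v : fibSpace Q₁),
      ⟪((w₁₀ u : 𝓚)), ((v : 𝓚))⟫_ℂ = ⟪((u : 𝓚)), ((w₀₁ v : 𝓚))⟫_ℂ) := by
  obtain ⟨T₀, b₀⟩ := exists_isBoundaryValue hl0 hQ₀ hε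
  obtain ⟨T₁, b₁⟩ := exists_isBoundaryValue hl1 hQ₁ hε
  obtain ⟨T₂, b₂⟩ := exists_isBoundaryValue hl2 hQ₂ hε
  have h01 : IsSum H₁ (sandwich F (-J₁₀)) H₀ := by
    rw [sandwich_neg]
    exact h10.symm (isSelfAdjoint_sandwich F hJ₁₀)
  have h00 : IsSum H₀ (sandwich F 0) H₀ := by
    intro z _
    ext f
    simp [sandwich]
  have iso₁₀ := hw₁₀.norm_apply b₀ b₁ hε hJ₁₀ h10
  have iso₀₁ := hw₀₁.norm_apply b₁ b₀ hε hJ₁₀.neg h01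
  have adj := hw₁₀.inner_apply hw₀₁
  refine ⟨?_, iso₁₀, fun v => ⟨w₀₁ v, ?_⟩, fun w₀₀ hw₀₀ u => ?_, adj⟩
  · refine ContinuousLinearMap.coeFn_injective ((denseRange_toFib Q₀).equalizer
      w₂₀.continuous (w₂₁ ∘L w₁₀).continuous (funext fun ψ => ?_))
    simp only [Function.comp_apply, ContinuousLinearMap.comp_apply]
    rw [hw₂₀.apply_toFib b₀ b₂ hε h20, hw₁₀.apply_toFib b₀ b₁ hε h10,
      hw₂₁.apply_toFib b₁ b₂ hε h21]
    refine Subtype.ext (sub_eq_zero.mp ?_)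
    simp only [toFib]
    rw [← map_sub]
    refine b₂.apply_eq_zero hε ?_
    rw [map_sub, b₀.apply_eq b₂ hε h20, b₁.apply_eq b₂ hε h21, b₀.apply_eq b₁ hε h10, sub_self]
  · rw [← sub_eq_zero, ← norm_eq_zero, ← sq_eq_zero_iff, norm_sub_sq (𝕜 := ℂ), iso₁₀, iso₀₁]
    have e : ⟪w₁₀ (w₀₁ v), v⟫_ℂ = ⟪w₀₁ v, w₀₁ v⟫_ℂ := adj (w₀₁ v) v
    rw [e, inner_self_eq_norm_sq, iso₀₁]
    ring
  · refine congrFun ((denseRange_toFib Q₀).equalizer w₀₀.continuous continuous_id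
      (funext fun ψ => ?_)) u
    simpa using hw₀₀.apply_toFib b₀ b₀ hε h00 ψ

end SSF
end
end
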